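/- arXiv:1706.01441 — 2 statements merged into one kernel-verified Lean document; each statement's English description precedes it below -/
import Mathlib

section
/- Let Ω ⊆ ℂⁿ be a bounded domain with smooth boundary defined by φ ∈ C^∞(Ω̄), φ < 0 on Ω, φ = 0 and dφ ≠ 0 on ∂Ω, with φ plurisubharmonic. Let p ∈ ∂Ω, suppose (i∂∂̄φ)^k = 0 in a neighborhood of p, and let ψ be smooth on a neighborhood of Ω̄. Set φ̃ = −log(−φ), ω_ε = i∂∂̄(εψ + φ̃), and δ > k. Then e^{ψ − δφ̃} dV_{ω_ε} = e^ψ (−φ)^δ · (n!)^{-1} ω_ε^n is integrable in a neighborhood of p in Ω. -/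
open scoped ComplexOrder

/-- The Wirtinger derivative `∂f/∂z_j` of a real-valued function on `ℂⁿ`. -/
noncomputable def wderiv (n : ℕ) (f : EuclideanSpace ℂ (Fin n) → ℝ)
    (z : EuclideanSpace ℂ (Fin n)) (j : Fin n) : ℂ :=
  (1 / 2) * ((fderiv ℝ f z (EuclideanSpace.single j 1) : ℂ)
    - Complex.I * (fderiv ℝ f z (EuclideanSpace.single j Complex.I) : ℂ))

/-- The conjugate Wirtinger derivative `∂f/∂z̄_k` of a real-valued function on `ℂⁿ`. -/
noncomputable def wbar (n : ℕ) (f : EuclideanSpace ℂ (Fin n) → ℝ) (k : Fin n)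
    (z : EuclideanSpace ℂ (Fin n)) : ℂ :=
  (1 / 2) * ((fderiv ℝ f z (EuclideanSpace.single k 1) : ℂ)
    + Complex.I * (fderiv ℝ f z (EuclideanSpace.single k Complex.I) : ℂ))

/-- The complex Hessian matrix `(∂²f/∂z_j∂z̄_k)_{j,k}`; the (1,1)-form `i∂∂̄f`
corresponds to this Hermitian matrix. -/
noncomputable def cHess (n : ℕ) (f : EuclideanSpace ℂ (Fin n) → ℝ)
    (z : EuclideanSpace ℂ (Fin n)) : Matrix (Fin n) (Fin n) ℂ :=
  Matrix.of fun j k =>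
    (1 / 2) * (fderiv ℝ (wbar n f k) z (EuclideanSpace.single j 1)
      - Complex.I * fderiv ℝ (wbar n f k) z (EuclideanSpace.single j Complex.I))

/-- The rank-one matrix `((∂φ/∂z_j)(∂φ/∂z_k)^-)_{j,k}` corresponding to the
(1,1)-form `i∂φ∧∂̄φ`. -/
noncomputable def gradForm (n : ℕ) (f : EuclideanSpace ℂ (Fin n) → ℝ)
    (z : EuclideanSpace ℂ (Fin n)) : Matrix (Fin n) (Fin n) ℂ :=
  Matrix.of fun j k => wderiv n f z j * (starRingEnd ℂ) (wderiv n f z k)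

/-- The density of the wedge product `α₁ ∧ ⋯ ∧ αₙ` of `(1,1)`-forms with
coefficient matrices `A 1, …, A n`, relative to the standard volume form. -/
noncomputable def wedgeDensity (n : ℕ) (A : Fin n → Matrix (Fin n) (Fin n) ℂ) : ℂ :=
  ∑ σ : Equiv.Perm (Fin n), ∑ π : Equiv.Perm (Fin n),
    ((Equiv.Perm.sign σ : ℤ) : ℂ) * ∏ i, A (π i) (σ i) i

noncomputable instance (n : ℕ) : MeasurableSpace (EuclideanSpace ℂ (Fin n)) := borel _
instance (n : ℕ) : BorelSpace (EuclideanSpace ℂ (Fin n)) := ⟨rfl⟩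
/-- Lebesgue (Haar) measure on `ℂⁿ`. -/
noncomputable instance (n : ℕ) : MeasureTheory.MeasureSpace (EuclideanSpace ℂ (Fin n)) :=
  ⟨MeasureTheory.Measure.addHaar⟩

open MeasureTheory


theorem aux_int1 (a : ℝ) (ha : -1 < a) (R : ℝ) (hR : 0 ≤ R) :
    IntegrableOn (fun t : ℝ => |t| ^ a) (Set.Icc (-R) R) := by
  have h0 : IntervalIntegrable (fun t : ℝ => |t| ^ a) volume 0 R := by
    refine (intervalIntegral.intervalIntegrable_rpow' ha (a := 0) (b := R)).congr ?_
    intro x hx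
    rw [Set.uIoc_of_le hR] at hx
    simp [abs_of_pos hx.1]
  have h1 : IntervalIntegrable (fun t : ℝ => |t| ^ a) volume (-R) 0 := by
    have := ((IntervalIntegrable.iff_comp_neg (by simp)).mp h0).symm
    simpa using this
  have := h1.trans h0
  rwa [intervalIntegrable_iff_integrableOn_Icc_of_le (by linarith)] at this

theorem aux_lin {E : Type*} [NormedAddCommGroup E] [NormedSpace ℝ E] [FiniteDimensional ℝ E]
    [MeasurableSpace E] [BorelSpace E] (μ : Measure E) [μ.IsAddHaarMeasure]
    (L : E →L[ℝ] ℝ) (e : E) (he : L e = 1) (a : ℝ) (ha : -1 < a) (R : ℝ) :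
    IntegrableOn (fun y => |L y| ^ a) (Metric.closedBall 0 R) μ := by
  let K := LinearMap.ker (L : E →ₗ[ℝ] ℝ)
  let Φ₀ : (ℝ × K) ≃ₗ[ℝ] E :=
    { toFun := fun q => q.1 • e + q.2
      map_add' := by intro x y; simp [add_smul]; abel
      map_smul' := by intro c x; simp [mul_smul]
      invFun := fun y => (L y, ⟨y - L y • e, by simp [K, he]⟩)
      left_inv := by
        rintro ⟨t, x, hx⟩
        have hx' : L x = 0 := hx
        simp [he, hx']
      right_inv := by intro y; simp }
  let Φ := Φ₀.toContinuousLinearEquiv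
  let ν : Measure (ℝ × K) := (volume : Measure ℝ).prod (Measure.addHaar : Measure K)
  have hν : (ν.map Φ).IsAddHaarMeasure := Φ.isAddHaarMeasure_map ν
  rw [Measure.isAddLeftInvariant_eq_smul μ (ν.map Φ)]
  have key : IntegrableOn (fun y => |L y| ^ a) (Metric.closedBall 0 R) (ν.map Φ) := by
    change IntegrableOn (fun y => |L y| ^ a) (Metric.closedBall 0 R) (ν.map Φ.toHomeomorph)
    rw [Φ.toHomeomorph.measurableEmbedding.integrableOn_map_iff (μ := ν)
      (f := fun y => |L y| ^ a) (s := Metric.closedBall 0 R)]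
    have hf : ((fun y => |L y| ^ a) ∘ Φ.toHomeomorph) = fun q : ℝ × K => |q.1| ^ a := by
      funext q
      have : L (q.2 : E) = 0 := q.2.2
      change |L (q.1 • e + q.2)| ^ a = _
      simp [he, this]
    rw [hf]
    have hbd : Bornology.IsBounded (Φ.toHomeomorph ⁻¹' Metric.closedBall 0 R) := by
      have := Φ.symm.lipschitz.isBounded_image
        (Metric.isBounded_closedBall (x := (0:E)) (r := R))
      rw [← Homeomorph.image_symm] 
      exact this
    obtain ⟨r, hr⟩ := hbd.subset_closedBall 0
    have : IntegrableOn (fun q : ℝ × K => |q.1| ^ a)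
        (Set.Icc (-|r|) |r| ×ˢ Metric.closedBall 0 |r|) ν := by
      unfold IntegrableOn
      rw [← Measure.prod_restrict]
      have : IsFiniteMeasure ((Measure.addHaar : Measure K).restrict (Metric.closedBall 0 |r|)) :=
        ⟨by simpa using (isCompact_closedBall (0 : K) |r|).measure_lt_top⟩
      exact Integrable.comp_fst (aux_int1 a ha |r| (abs_nonneg r)) _
    refine this.mono_set (hr.trans ?_)
    intro q hq
    have hq' : ‖q‖ ≤ |r| := by
      have := mem_closedBall_zero_iff.mp hq
      exact this.trans (le_abs_self r)
    have h1 := (norm_fst_le q).trans hq'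
    have h2 := (norm_snd_le q).trans hq'
    refine ⟨?_, by simpa using h2⟩
    rw [Real.norm_eq_abs] at h1
    exact abs_le.mp h1
  unfold IntegrableOn
  rw [Measure.restrict_smul]
  exact Integrable.smul_measure_nnreal key

theorem aux_nl {E : Type*} [NormedAddCommGroup E] [NormedSpace ℝ E] [FiniteDimensional ℝ E]
    [MeasurableSpace E] [BorelSpace E] (μ : Measure E) [μ.IsAddHaarMeasure]
    (φ : E → ℝ) (p : E) (hφ : ContDiffAt ℝ (⊤ : ℕ∞) φ p) (hd : fderiv ℝ φ p ≠ 0)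
    (a : ℝ) (ha : -1 < a) :
    ∃ U ∈ nhds p, IntegrableOn (fun z => |φ z| ^ a) U μ := by
  set L := fderiv ℝ φ p with hL
  obtain ⟨e, he⟩ : ∃ e, L e = 1 := by
    obtain ⟨v, hv⟩ : ∃ v, L v ≠ 0 := by
      by_contra! h
      exact hd (ContinuousLinearMap.ext h)
    exact ⟨(L v)⁻¹ • v, by simp [hv]⟩
  let G : E → E := fun z => z + (φ z - L z) • e
  have hLG : ∀ z, L (G z) = φ z := by intro z; simp [G, he]
  have hG : ContDiffAt ℝ (⊤ : ℕ∞) G p := by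
    exact contDiffAt_id.add ((hφ.sub L.contDiff.contDiffAt).smul contDiffAt_const)
  have hGd : HasFDerivAt G (ContinuousLinearMap.id ℝ E) p := by
    have h1 := (hφ.differentiableAt (by simp)).hasFDerivAt
    have := (hasFDerivAt_id (𝕜 := ℝ) p).add ((h1.sub L.hasFDerivAt).smul_const e)
    refine this.congr_fderiv ?_
    ext v
    simp [hL]
  have hGs : HasStrictFDerivAt G ((ContinuousLinearEquiv.refl ℝ E : E ≃L[ℝ] E) : E →L[ℝ] E) p :=
    hG.hasStrictFDerivAt' hGd (by simp)
  let H := hGs.toOpenPartialHomeomorph G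
  have hinj : Set.InjOn G H.source := H.injOn
  have hHs : H.source ∈ nhds p := H.open_source.mem_nhds hGs.mem_toOpenPartialHomeomorph_source
  have hdet : ∀ᶠ z in nhds p, 1 / 2 < |(fderiv ℝ G z).det| := by
    have hc : ContinuousAt (fun z => |(fderiv ℝ G z).det|) p := by
      refine ContinuousAt.abs ?_
      exact ContinuousLinearMap.continuous_det.continuousAt.comp
        (hG.continuousAt_fderiv (by simp))
    have hv : |(fderiv ℝ G p).det| = 1 := by
      rw [hGd.fderiv]; simp [ContinuousLinearMap.det]
    exact hc.eventually_const_lt (by simp only [hv]; norm_num)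
  have hdiff : ∀ᶠ z in nhds p, DifferentiableAt ℝ G z := by
    filter_upwards [(hG.of_le (m := 1) (by simp)).eventually (by simp)] with z hz using hz.differentiableAt (by simp)
  have hbd : ∀ᶠ z in nhds p, ‖G z‖ < ‖G p‖ + 1 :=
    hG.continuousAt.norm.eventually_lt_const (by linarith)
  have hφc : ∀ᶠ z in nhds p, ContinuousAt φ z := by
    filter_upwards [(hφ.of_le (m := 1) (by simp)).eventually (by simp)] with z hz using hz.continuousAt
  obtain ⟨U, hU, hUo, hpU⟩ := mem_nhds_iff.mp (Filter.inter_mem hHs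
    (hdet.and (hdiff.and (hbd.and hφc))))
  refine ⟨U, hUo.mem_nhds hpU, ?_⟩
  have himg : IntegrableOn (fun y => |L y| ^ a) (G '' U) μ := by
    refine (aux_lin μ L e he a ha (‖G p‖ + 1)).mono_set ?_
    rintro _ ⟨z, hz, rfl⟩
    simpa using (hU hz).2.2.2.1.le
  rw [integrableOn_image_iff_integrableOn_abs_det_fderiv_smul μ hUo.measurableSet
    (fun z hz => (hU hz).2.2.1.hasFDerivAt.hasFDerivWithinAt)
    (hinj.mono fun z hz => (hU hz).1)] at himg
  refine Integrable.mono' (himg.const_mul 2) ?_ ?_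
  · have : Measurable (fun x : ℝ => |x| ^ a) := by fun_prop
    refine (this.comp_aemeasurable ?_).aestronglyMeasurable
    exact ContinuousOn.aemeasurable
      (fun z hz => (hU hz).2.2.2.2.continuousWithinAt) hUo.measurableSet
  · filter_upwards [ae_restrict_mem hUo.measurableSet] with z hz
    have h1 := (hU hz).2.1
    simp only [hLG, smul_eq_mul]
    have h2 : 0 ≤ |φ z| ^ a := by positivity
    rw [Real.norm_of_nonneg h2]
    nlinarith

theorem aux_det {n k : ℕ} (M : Fin 3 → Matrix (Fin n) (Fin n) ℂ)
    (h1 : (M 1).rank < k) (h2 : (M 2).rank ≤ 1) (s C : ℝ) (hs : 1 ≤ s)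
    (hC : ∀ r : Fin n → Fin 3, ‖Matrix.det (Matrix.of fun i => M (r i) i)‖ ≤ C) :
    ‖Matrix.det (M 0 + (s : ℂ) • M 1 + ((s : ℂ) ^ 2) • M 2)‖
      ≤ Fintype.card (Fin n → Fin 3) * (C * s ^ (k + 1)) := by
  have hrank : ∀ (r : Fin n → Fin 3) (j : Fin 3),
      Matrix.det (Matrix.of fun i => M (r i) i) ≠ 0 →
      (Finset.univ.filter fun i => r i = j).card ≤ (M j).rank := by
    intro r j hdet
    have hli : LinearIndependent ℂ (fun i => M (r i) i) := by
      have := Matrix.linearIndependent_rows_iff_isUnit.mpr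
        ((Matrix.isUnit_iff_isUnit_det _).mpr (isUnit_iff_ne_zero.mpr hdet))
      exact this
    have hli2 := hli.comp (fun i : {i // r i = j} => (i : Fin n)) Subtype.val_injective
    rw [Matrix.rank_eq_finrank_span_row]
    have h3 := finrank_span_eq_card hli2
    rw [← Fintype.card_subtype, ← h3]
    refine Submodule.finrank_mono (Submodule.span_mono ?_)
    rintro _ ⟨⟨i, hi⟩, rfl⟩
    exact ⟨i, by simp [Matrix.row, hi]⟩
  have hexp : Matrix.det (M 0 + (s : ℂ) • M 1 + ((s : ℂ) ^ 2) • M 2)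
      = ∑ r : Fin n → Fin 3, (∏ i, (s : ℂ) ^ ((r i : Fin 3) : ℕ)) •
          Matrix.det (Matrix.of fun i => M (r i) i) := by
    have h := (Matrix.detRowAlternating (R := ℂ) (n := Fin n)).toMultilinearMap.map_sum
      (fun i (j : Fin 3) => (s : ℂ) ^ ((j : Fin 3) : ℕ) • M j i)
    have hl : (fun i => ∑ j : Fin 3, (s : ℂ) ^ ((j : Fin 3) : ℕ) • M j i)
        = (M 0 + (s : ℂ) • M 1 + ((s : ℂ) ^ 2) • M 2) := by
      funext i l
      simp [Fin.sum_univ_three]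
    rw [hl] at h
    refine h.trans (Finset.sum_congr rfl fun r _ => ?_)
    exact MultilinearMap.map_smul_univ _ (fun i => (s : ℂ) ^ ((r i : Fin 3) : ℕ)) (fun i => M (r i) i)
  rw [hexp]
  refine (norm_sum_le _ _).trans ?_
  have : ∀ r ∈ (Finset.univ : Finset (Fin n → Fin 3)),
      ‖(∏ i, (s : ℂ) ^ ((r i : Fin 3) : ℕ)) • Matrix.det (Matrix.of fun i => M (r i) i)‖
        ≤ C * s ^ (k + 1) := by
    intro r _
    have hC0 : 0 ≤ C := (norm_nonneg _).trans (hC r)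
    by_cases hdet : Matrix.det (Matrix.of fun i => M (r i) i) = 0
    · rw [hdet]; simp; positivity
    · have e1 := hrank r 1 hdet
      have e2 := hrank r 2 hdet
      have hsum : ∑ i, ((r i : Fin 3) : ℕ) ≤ k + 1 := by
        have : ∑ i, ((r i : Fin 3) : ℕ) = (Finset.univ.filter fun i => r i = 1).card
            + 2 * (Finset.univ.filter fun i => r i = 2).card := by
          rw [Finset.card_filter, Finset.card_filter, Finset.mul_sum, ← Finset.sum_add_distrib]
          refine Finset.sum_congr rfl fun i _ => ?_
          generalize r i = x
          fin_cases x <;> simp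
        omega
      rw [norm_smul, Finset.prod_pow_eq_pow_sum, norm_pow, Complex.norm_real,
        Real.norm_of_nonneg (by linarith), mul_comm]
      exact mul_le_mul (hC r) (pow_le_pow_right₀ hs hsum) (by positivity) hC0
  refine (Finset.sum_le_sum this).trans ?_
  simp

theorem aux_wbar {n : ℕ} {f : EuclideanSpace ℂ (Fin n) → ℝ} {z : EuclideanSpace ℂ (Fin n)}
    (hf : ContDiffAt ℝ (⊤ : ℕ∞) f z) (k : Fin n) : ContDiffAt ℝ (⊤ : ℕ∞) (wbar n f k) z := by
  have h := hf.fderiv_right (m := (⊤ : ℕ∞)) (by simp)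
  have h2 : ∀ v, ContDiffAt ℝ (⊤ : ℕ∞) (fun w => ((fderiv ℝ f w v : ℝ) : ℂ)) z := fun v =>
    Complex.ofRealCLM.contDiff.contDiffAt.comp z (h.clm_apply contDiffAt_const)
  unfold wbar
  exact contDiffAt_const.mul ((h2 _).add (contDiffAt_const.mul (h2 _)))

theorem aux_wderiv {n : ℕ} {f : EuclideanSpace ℂ (Fin n) → ℝ} {z : EuclideanSpace ℂ (Fin n)}
    (hf : ContDiffAt ℝ (⊤ : ℕ∞) f z) (k : Fin n) : ContinuousAt (fun w => wderiv n f w k) z := by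
  have h := hf.fderiv_right (m := (⊤ : ℕ∞)) (by simp)
  have h2 : ∀ v, ContDiffAt ℝ (⊤ : ℕ∞) (fun w => ((fderiv ℝ f w v : ℝ) : ℂ)) z := fun v =>
    Complex.ofRealCLM.contDiff.contDiffAt.comp z (h.clm_apply contDiffAt_const)
  unfold wderiv
  exact (contDiffAt_const.mul ((h2 _).sub (contDiffAt_const.mul (h2 _)))).continuousAt

theorem aux_cHess {n : ℕ} {f : EuclideanSpace ℂ (Fin n) → ℝ} {z : EuclideanSpace ℂ (Fin n)}
    (hf : ContDiffAt ℝ (⊤ : ℕ∞) f z) : ContinuousAt (cHess n f) z := by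
  refine continuousAt_pi.mpr fun i => continuousAt_pi.mpr fun j => ?_
  have h := (aux_wbar hf j).fderiv_right (m := (⊤ : ℕ∞)) (by simp)
  have h2 : ∀ v, ContDiffAt ℝ (⊤ : ℕ∞) (fun w => fderiv ℝ (wbar n f j) w v) z := fun v =>
    h.clm_apply contDiffAt_const
  exact (contDiffAt_const.mul ((h2 _).sub (contDiffAt_const.mul (h2 _)))).continuousAt

theorem aux_formula {n : ℕ} {φ ψ : EuclideanSpace ℂ (Fin n) → ℝ} {z : EuclideanSpace ℂ (Fin n)}
    (hφ : ContDiffAt ℝ (⊤ : ℕ∞) φ z) (hψ : ContDiffAt ℝ (⊤ : ℕ∞) ψ z) (hz : φ z < 0) (ε : ℝ) :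
    cHess n (fun w => ε * ψ w + -Real.log (-(φ w))) z
      = (ε : ℂ) • cHess n ψ z + (((-φ z)⁻¹ : ℝ) : ℂ) • cHess n φ z
        + ((((-φ z)⁻¹ : ℝ) : ℂ) ^ 2) • gradForm n φ z := by
  have hev : ∀ᶠ w in nhds z, φ w < 0 ∧ DifferentiableAt ℝ φ w ∧ DifferentiableAt ℝ ψ w := by
    filter_upwards [hφ.continuousAt.eventually_lt_const hz,
      (hφ.of_le (m := 1) (by simp)).eventually (by simp),
      (hψ.of_le (m := 1) (by simp)).eventually (by simp)] with w h1 h2 h3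
    exact ⟨h1, h2.differentiableAt (by simp), h3.differentiableAt (by simp)⟩
  have hfd : ∀ᶠ w in nhds z, fderiv ℝ (fun w => ε * ψ w + -Real.log (-(φ w))) w
      = ε • fderiv ℝ ψ w + (-φ w)⁻¹ • fderiv ℝ φ w := by
    filter_upwards [hev] with w ⟨h1, h2, h3⟩
    have := (h3.hasFDerivAt.const_mul ε).add
      ((h2.hasFDerivAt.neg.log (neg_pos.mpr h1).ne').neg)
    refine (HasFDerivAt.fderiv this).trans ?_
    ext v; simp
  have hwb : ∀ k, wbar n (fun w => ε * ψ w + -Real.log (-(φ w))) k =ᶠ[nhds z]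
      fun w => (ε : ℂ) * wbar n ψ k w + (((-φ w)⁻¹ : ℝ) : ℂ) * wbar n φ k w := by
    intro k
    filter_upwards [hfd] with w hw
    simp only [wbar, hw]
    simp
    ring
  have hdw : ∀ k v, fderiv ℝ (wbar n (fun w => ε * ψ w + -Real.log (-(φ w))) k) z v
      = (ε : ℂ) * fderiv ℝ (wbar n ψ k) z v + (((-φ z)⁻¹ : ℝ) : ℂ) * fderiv ℝ (wbar n φ k) z v
        + ((((-φ z)⁻¹ : ℝ) : ℂ) ^ 2) * (fderiv ℝ φ z v : ℂ) * wbar n φ k z := by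
    intro k v
    rw [(hwb k).fderiv_eq]
    have a1 := ((aux_wbar hψ k).differentiableAt (by simp)).hasFDerivAt
    have a2 := ((aux_wbar hφ k).differentiableAt (by simp)).hasFDerivAt
    have a3 := (hφ.differentiableAt (by simp)).hasFDerivAt
    have hne : -φ z ≠ 0 := (neg_pos.mpr hz).ne'
    have a4 := (hasDerivAt_inv hne).comp_hasFDerivAt z a3.neg
    have a5 := Complex.ofRealCLM.hasFDerivAt.comp z a4
    have a6 := (a1.const_mul (ε : ℂ)).add (a5.mul a2)
    have := congrArg (fun T => T v) (HasFDerivAt.fderiv a6)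
    refine Eq.trans this ?_
    simp
    ring
  ext i j
  simp only [cHess, gradForm, Matrix.of_apply, Matrix.add_apply, Matrix.smul_apply, smul_eq_mul, hdw]
  have hcj : (starRingEnd ℂ) (wderiv n φ z j) = wbar n φ j z := by
    simp [wderiv, wbar]
    exact Or.inl (Complex.conj_ofNat 2)
  rw [hcj]
  simp only [wderiv]
  ring

/-- Lemma 5: near a boundary point `p` where `(i∂∂̄φ)^k = 0` (Hessian rank `< k`),
for `δ > k` the weighted volume form `e^{ψ - δφ̃} dV_{ω_ε} = e^ψ (-φ)^δ dV_{ω_ε}`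
is integrable, where `φ̃ = -log(-φ)`, `ω_ε = i∂∂̄(εψ + φ̃)`, and the volume form
`dV_{ω_ε}` has density (a constant multiple of) `det` of the complex Hessian of
`εψ + φ̃` with respect to Lebesgue measure. -/
theorem stmt5 (n k : ℕ) (hk : 1 ≤ k) (Ω : Set (EuclideanSpace ℂ (Fin n)))
    (hΩo : IsOpen Ω) (hb : Bornology.IsBounded Ω)
    (W : Set (EuclideanSpace ℂ (Fin n))) (hWo : IsOpen W) (hWΩ : closure Ω ⊆ W)
    (φ ψ : EuclideanSpace ℂ (Fin n) → ℝ)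
    (hφ : ContDiffOn ℝ (⊤ : ℕ∞) φ W) (hψ : ContDiffOn ℝ (⊤ : ℕ∞) ψ W)
    (hφneg : ∀ z ∈ Ω, φ z < 0)
    (hφ0 : ∀ z ∈ frontier Ω, φ z = 0)
    (hdφ : ∀ z ∈ frontier Ω, fderiv ℝ φ z ≠ 0)
    (hφpsh : ∀ z ∈ Ω, (cHess n φ z).PosSemidef)
    (p : EuclideanSpace ℂ (Fin n)) (hp : p ∈ frontier Ω)
    (hvanish : ∃ Wp ∈ nhds p, ∀ z ∈ Wp, (cHess n φ z).rank < k)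
    (ε δ : ℝ) (hε : 0 < ε) (hδ : (k : ℝ) < δ) :
    ∃ U ∈ nhds p, IntegrableOn
      (fun z => Real.exp (ψ z) * (-(φ z)) ^ δ *
        (Matrix.det (cHess n (fun w => ε * ψ w + -Real.log (-(φ w))) z)).re)
      (Ω ∩ U) := by
  have hpW : p ∈ W := hWΩ (frontier_subset_closure hp)
  have hφat : ∀ z ∈ W, ContDiffAt ℝ (⊤ : ℕ∞) φ z := fun z hz => hφ.contDiffAt (hWo.mem_nhds hz)
  have hψat : ∀ z ∈ W, ContDiffAt ℝ (⊤ : ℕ∞) ψ z := fun z hz => hψ.contDiffAt (hWo.mem_nhds hz)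
  have hΩW : Ω ⊆ W := subset_closure.trans hWΩ
  have : (volume : Measure (EuclideanSpace ℂ (Fin n))).IsAddHaarMeasure :=
    inferInstanceAs (Measure.addHaar : Measure (EuclideanSpace ℂ (Fin n))).IsAddHaarMeasure
  obtain ⟨U₀, hU₀, hint⟩ := aux_nl (volume : Measure (EuclideanSpace ℂ (Fin n))) φ p
    (hφat p hpW) (hdφ p hp) (δ - (k + 1)) (by linarith)
  obtain ⟨Wp, hWp, hrk⟩ := hvanish
  let M : EuclideanSpace ℂ (Fin n) → Fin 3 → Matrix (Fin n) (Fin n) ℂ := fun z =>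
    ![(ε : ℂ) • cHess n ψ z, cHess n φ z, gradForm n φ z]
  have hMc : ∀ j, ContinuousAt (fun z => M z j) p := by
    intro j
    fin_cases j
    · exact (aux_cHess (hψat p hpW)).const_smul (ε : ℂ)
    · exact aux_cHess (hφat p hpW)
    · refine continuousAt_pi.mpr fun i => continuousAt_pi.mpr fun l => ?_
      exact (aux_wderiv (hφat p hpW) i).mul
        (Complex.continuous_conj.continuousAt.comp (aux_wderiv (hφat p hpW) l))
  have hdc : ∀ r : Fin n → Fin 3,
      ContinuousAt (fun z => ‖Matrix.det (Matrix.of fun i => M z (r i) i)‖) p := by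
    intro r
    refine ContinuousAt.norm ?_
    have h1 : ContinuousAt (fun z => (Matrix.of fun i => M z (r i) i)) p := by
      refine continuousAt_pi.mpr fun i => ?_
      exact continuousAt_pi.mp (hMc (r i)) i
    exact (Continuous.matrix_det continuous_id).continuousAt.comp h1
  let C : ℝ := ∑ r : Fin n → Fin 3, (‖Matrix.det (Matrix.of fun i => M p (r i) i)‖ + 1)
  have hdb : ∀ᶠ z in nhds p, ∀ r : Fin n → Fin 3,
      ‖Matrix.det (Matrix.of fun i => M z (r i) i)‖ ≤ C := by
    rw [Filter.eventually_all]
    intro r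
    have hlt : ‖Matrix.det (Matrix.of fun i => M p (r i) i)‖ < C := by
      refine lt_of_lt_of_le (lt_add_one _) ?_
      exact Finset.single_le_sum
        (f := fun r : Fin n → Fin 3 => ‖Matrix.det (Matrix.of fun i => M p (r i) i)‖ + 1)
        (fun r _ => by positivity) (Finset.mem_univ r)
    exact ((hdc r).eventually_lt_const hlt).mono fun z hz => hz.le
  have hψb : ∀ᶠ z in nhds p, ψ z < ψ p + 1 :=
    (hψat p hpW).continuousAt.eventually_lt_const (by linarith)
  have hφb : ∀ᶠ z in nhds p, -1 < φ z :=
    (hφat p hpW).continuousAt.eventually_const_lt (by rw [hφ0 p hp]; norm_num)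
  obtain ⟨U, hU, hUo, hpU⟩ := mem_nhds_iff.mp (Filter.inter_mem (Filter.inter_mem hU₀ hWp)
    (hdb.and (hψb.and hφb)))
  refine ⟨U, hUo.mem_nhds hpU, ?_⟩
  have hint' : IntegrableOn (fun z => |φ z| ^ (δ - (k + 1))) (Ω ∩ U) :=
    hint.mono_set fun z hz => (hU hz.2).1.1
  have hms : MeasurableSet (Ω ∩ U) := (hΩo.inter hUo).measurableSet
  let N : ℝ := Fintype.card (Fin n → Fin 3)
  refine Integrable.mono' (hint'.const_mul (Real.exp (ψ p + 1) * (N * C))) ?_ ?_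
  · refine ContinuousOn.aestronglyMeasurable (fun z hz => ContinuousAt.continuousWithinAt ?_) hms
    have hzW := hΩW hz.1
    have hneg := hφneg z hz.1
    have hf : ContDiffAt ℝ (⊤ : ℕ∞) (fun w => ε * ψ w + -Real.log (-(φ w))) z :=
      (contDiffAt_const.mul (hψat z hzW)).add ((hφat z hzW).neg.log (neg_pos.mpr hneg).ne').neg
    refine ((hψat z hzW).continuousAt.rexp.mul ?_).mul ?_
    · exact (hφat z hzW).continuousAt.neg.rpow_const (Or.inl (neg_pos.mpr hneg).ne')
    · have h1 := aux_cHess hf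
      exact Complex.continuous_re.continuousAt.comp
        ((Continuous.matrix_det continuous_id).continuousAt.comp h1)
  · filter_upwards [ae_restrict_mem hms] with z hz
    have hzW := hΩW hz.1
    have hneg := hφneg z hz.1
    obtain ⟨⟨-, hzp⟩, hzC, hzψ, hzφ⟩ := hU hz.2
    have ht : 0 < -φ z := by linarith
    have hs : 1 ≤ (-φ z)⁻¹ := (one_le_inv₀ ht).mpr (by linarith)
    have hdet := aux_det (k := k) (M z) (hrk z hzp) (by
      have := Matrix.rank_vecMulVec_le (fun i => wderiv n φ z i)
        (fun i => (starRingEnd ℂ) (wderiv n φ z i))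
      exact this) (-φ z)⁻¹ C hs hzC
    have hform := aux_formula (hφat z hzW) (hψat z hzW) hneg ε
    have hdet' : ‖Matrix.det (cHess n (fun w => ε * ψ w + -Real.log (-(φ w))) z)‖
        ≤ N * (C * (-φ z)⁻¹ ^ (k + 1)) := by
      rw [hform]; exact hdet
    have hre := (Complex.abs_re_le_norm _).trans hdet'
    rw [norm_mul, norm_mul, Real.norm_of_nonneg (Real.exp_pos _).le,
      Real.norm_of_nonneg (Real.rpow_nonneg ht.le _), Real.norm_eq_abs, abs_of_neg hneg]
    have hpow : (-φ z) ^ (δ - (k + 1)) = (-φ z) ^ δ * (-φ z)⁻¹ ^ (k + 1) := by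
      rw [Real.rpow_sub ht, inv_pow, div_eq_mul_inv]
      congr 2
      exact_mod_cast Real.rpow_natCast (-φ z) (k + 1)
    rw [hpow]
    have hexp : Real.exp (ψ z) ≤ Real.exp (ψ p + 1) := Real.exp_le_exp.mpr hzψ.le
    calc _ ≤ Real.exp (ψ p + 1) * (-φ z) ^ δ * (N * (C * (-φ z)⁻¹ ^ (k + 1))) := by
          gcongr
      _ = _ := by ring
end

section
/- Let Ω ⊆ ℂⁿ be a bounded domain with φ ∈ C^∞(Ω̄) plurisubharmonic, φ < 0 on Ω, φ → 0 at ∂Ω, and v ≥ 0 a plurisubharmonic function in C^∞(Ω̄). Then ∫_Ω φ² i∂∂̄v ∧ (i∂∂̄φ)^{n−1} ≤ 2 ∫_Ω v i∂φ ∧ ∂̄φ ∧ (i∂∂̄φ)^{n−1}. -/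
open scoped ComplexOrder

open MeasureTheory

/-- A first-order operator with complex coefficients: `c = -I` gives `∂/∂z_j`,
`c = I` gives `∂/∂z̄_j`. -/
noncomputable def Dop {n : ℕ} (c : ℂ) (j : Fin n) (F : EuclideanSpace ℂ (Fin n) → ℂ)
    (z : EuclideanSpace ℂ (Fin n)) : ℂ :=
  (1 / 2) * (fderiv ℝ F z (EuclideanSpace.single j 1)
    + c * fderiv ℝ F z (EuclideanSpace.single j Complex.I))

section DopLemmas

variable {n : ℕ} {c d : ℂ} {j k : Fin n} {F G : EuclideanSpace ℂ (Fin n) → ℂ}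
  {z : EuclideanSpace ℂ (Fin n)} {Ω : Set (EuclideanSpace ℂ (Fin n))}

lemma Dop_congr (h : F =ᶠ[nhds z] G) : Dop c j F z = Dop c j G z := by
  simp only [Dop, h.fderiv_eq]

lemma Dop_mul (hF : DifferentiableAt ℝ F z) (hG : DifferentiableAt ℝ G z) :
    Dop c j (fun w => F w * G w) z = Dop c j F z * G z + F z * Dop c j G z := by
  simp only [Dop]
  rw [fderiv_fun_mul hF hG]
  simp only [add_apply, smul_apply, smul_eq_mul]
  ring

lemma Dop_contDiffOn (hΩ : IsOpen Ω) (hF : ContDiffOn ℝ (⊤ : ℕ∞) F Ω) :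
    ContDiffOn ℝ (⊤ : ℕ∞) (Dop c j F) Ω := by
  have h1 : ContDiffOn ℝ (⊤ : ℕ∞) (fderiv ℝ F) Ω :=
    hF.fderiv_of_isOpen hΩ (by simp)
  unfold Dop
  exact contDiffOn_const.mul ((h1.clm_apply contDiffOn_const).add
    (contDiffOn_const.mul (h1.clm_apply contDiffOn_const)))

lemma Dop_comm (hF : ContDiffAt ℝ (⊤ : ℕ∞) F z) :
    Dop c j (Dop d k F) z = Dop d k (Dop c j F) z := by
  have hs : IsSymmSndFDerivAt ℝ F z := hF.isSymmSndFDerivAt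
    (by rw [minSmoothness_of_isRCLikeNormedField]; exact WithTop.coe_le_coe.2 (le_top : (2 : ℕ∞) ≤ ⊤))
  have hd : DifferentiableAt ℝ (fderiv ℝ F) z :=
    (hF.fderiv_right (m := 1) (by exact WithTop.coe_le_coe.2 (le_top : (1 + 1 : ℕ∞) ≤ ⊤))).differentiableAt one_ne_zero
  have key : ∀ (d : ℂ) (k : Fin n) (u : EuclideanSpace ℂ (Fin n)), fderiv ℝ (Dop d k F) z u =
      (1 / 2) * (fderiv ℝ (fderiv ℝ F) z u (EuclideanSpace.single k 1)
        + d * fderiv ℝ (fderiv ℝ F) z u (EuclideanSpace.single k Complex.I)) := by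
    intro d k u
    have h1 : ∀ w : EuclideanSpace ℂ (Fin n), HasFDerivAt (fun x => fderiv ℝ F x w)
        ((fderiv ℝ (fderiv ℝ F) z).flip w) z := by
      intro w
      have := hd.hasFDerivAt.clm_apply (hasFDerivAt_const w z)
      have e : fderiv ℝ F z ∘SL (0 : EuclideanSpace ℂ (Fin n) →L[ℝ] EuclideanSpace ℂ (Fin n))
          + (fderiv ℝ (fderiv ℝ F) z).flip w = (fderiv ℝ (fderiv ℝ F) z).flip w := by
        rw [ContinuousLinearMap.comp_zero, zero_add]
      rwa [e] at this
    have h2 := (((h1 (EuclideanSpace.single k 1)).add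
      ((h1 (EuclideanSpace.single k Complex.I)).const_mul d)).const_mul (1 / 2 : ℂ)).fderiv
    have h3 : fderiv ℝ (Dop d k F) z = _ := h2
    rw [h3]
    simp
    ring
  have e1 : Dop c j (Dop d k F) z = (1 / 2) * (fderiv ℝ (Dop d k F) z (EuclideanSpace.single j 1)
    + c * fderiv ℝ (Dop d k F) z (EuclideanSpace.single j Complex.I)) := rfl
  have e2 : Dop d k (Dop c j F) z = (1 / 2) * (fderiv ℝ (Dop c j F) z (EuclideanSpace.single k 1)
    + d * fderiv ℝ (Dop c j F) z (EuclideanSpace.single k Complex.I)) := rfl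
  rw [e1, e2]
  simp only [key]
  rw [hs (EuclideanSpace.single k 1) (EuclideanSpace.single j 1),
    hs (EuclideanSpace.single k 1) (EuclideanSpace.single j Complex.I),
    hs (EuclideanSpace.single k Complex.I) (EuclideanSpace.single j 1),
    hs (EuclideanSpace.single k Complex.I) (EuclideanSpace.single j Complex.I)]
  ring

lemma Dop_real_comp {h : ℝ → ℝ} {φ : EuclideanSpace ℂ (Fin n) → ℝ}
    (hh : DifferentiableAt ℝ h (φ z)) (hφ : DifferentiableAt ℝ φ z) :
    Dop c j (fun w => ((h (φ w) : ℝ) : ℂ)) z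
      = ((deriv h (φ z) : ℝ) : ℂ) * Dop c j (fun w => ((φ w : ℝ) : ℂ)) z := by
  have h1 : ∀ {f : EuclideanSpace ℂ (Fin n) → ℝ}, DifferentiableAt ℝ f z →
      ∀ u, fderiv ℝ (fun w => ((f w : ℝ) : ℂ)) z u = ((fderiv ℝ f z u : ℝ) : ℂ) := by
    intro f hf u
    have := (Complex.ofRealCLM.hasFDerivAt.comp z hf.hasFDerivAt).fderiv
    have h' : fderiv ℝ (fun w => ((f w : ℝ) : ℂ)) z = _ := this
    rw [h']; simp
  have h2 : HasFDerivAt (fun w => h (φ w)) (deriv h (φ z) • fderiv ℝ φ z) z :=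
    hh.hasDerivAt.comp_hasFDerivAt z hφ.hasFDerivAt
  simp only [Dop, h1 hφ, h1 h2.differentiableAt, h2.fderiv]
  simp
  ring

lemma Dop_ofReal {f : EuclideanSpace ℂ (Fin n) → ℝ} (hf : DifferentiableAt ℝ f z) :
    Dop c j (fun w => ((f w : ℝ) : ℂ)) z = (1 / 2) * ((fderiv ℝ f z (EuclideanSpace.single j 1) : ℂ)
    + c * (fderiv ℝ f z (EuclideanSpace.single j Complex.I) : ℂ)) := by
  have h1 : ∀ u, fderiv ℝ (fun w => ((f w : ℝ) : ℂ)) z u = ((fderiv ℝ f z u : ℝ) : ℂ) := by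
    intro u
    have := (Complex.ofRealCLM.hasFDerivAt.comp z hf.hasFDerivAt).fderiv
    have h' : fderiv ℝ (fun w => ((f w : ℝ) : ℂ)) z = _ := this
    rw [h']; simp
  simp only [Dop, h1]

lemma wbar_eq_Dop {f : EuclideanSpace ℂ (Fin n) → ℝ} (hf : DifferentiableAt ℝ f z) :
    wbar n f k z = Dop Complex.I k (fun w => ((f w : ℝ) : ℂ)) z := by
  rw [Dop_ofReal hf]; rfl

lemma wderiv_eq_Dop {f : EuclideanSpace ℂ (Fin n) → ℝ} (hf : DifferentiableAt ℝ f z) :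
    wderiv n f z k = Dop (-Complex.I) k (fun w => ((f w : ℝ) : ℂ)) z := by
  rw [Dop_ofReal hf]; simp only [wderiv]; ring

lemma conj_wderiv {f : EuclideanSpace ℂ (Fin n) → ℝ} :
    (starRingEnd ℂ) (wderiv n f z k) = wbar n f k z := by
  simp [wderiv, wbar]
  left
  exact Complex.conj_ofNat 2

lemma cHess_eq_Dop (hΩ : IsOpen Ω) {f : EuclideanSpace ℂ (Fin n) → ℝ}
    (hf : ContDiffOn ℝ (⊤ : ℕ∞) f Ω) (hz : z ∈ Ω) :
    cHess n f z j k = Dop (-Complex.I) j (Dop Complex.I k (fun w => ((f w : ℝ) : ℂ))) z := by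
  have h : wbar n f k =ᶠ[nhds z] Dop Complex.I k (fun w => ((f w : ℝ) : ℂ)) := by
    filter_upwards [hΩ.mem_nhds hz] with w hw
    exact wbar_eq_Dop ((hf.contDiffAt (hΩ.mem_nhds hw)).differentiableAt (by simp))
  rw [← Dop_congr h]
  simp only [cHess, Dop, Matrix.of_apply]
  ring

/-- Derivative of a determinant. -/
lemma Dop_det {M : EuclideanSpace ℂ (Fin n) → Matrix (Fin n) (Fin n) ℂ}
    (hM : ∀ a b, DifferentiableAt ℝ (fun w => M w a b) z) :
    Dop c j (fun w => (M w).det) z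
      = ∑ l, ((M z).updateRow l (fun b => Dop c j (fun w => M w l b) z)).det := by
  have hdet : ∀ (A : Matrix (Fin n) (Fin n) ℂ) (l : Fin n) (r : Fin n → ℂ),
      (A.updateRow l r).det = ∑ σ : Equiv.Perm (Fin n), ((Equiv.Perm.sign σ : ℤ) : ℂ) *
        ((∏ i ∈ Finset.univ.erase l, A i (σ i)) * r (σ l)) := by
    intro A l r
    rw [← Matrix.det_transpose, Matrix.det_apply']
    refine Finset.sum_congr rfl fun σ _ => ?_
    congr 1
    rw [← Finset.prod_erase_mul _ _ (Finset.mem_univ l)]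
    simp only [Matrix.transpose_apply, Matrix.updateRow_self]
    congr 1
    refine Finset.prod_congr rfl fun i hi => ?_
    rw [Matrix.updateRow_ne (Finset.ne_of_mem_erase hi)]
  have hd : HasFDerivAt (fun w => (M w).det)
      (∑ σ : Equiv.Perm (Fin n), ((Equiv.Perm.sign σ : ℤ) : ℂ) •
        ∑ l, (∏ i ∈ Finset.univ.erase l, M z i (σ i)) • fderiv ℝ (fun w => M w l (σ l)) z) z := by
    have : (fun w => (M w).det) = fun w => ∑ σ : Equiv.Perm (Fin n),
        ((Equiv.Perm.sign σ : ℤ) : ℂ) * ∏ i, M w i (σ i) := by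
      funext w
      rw [← Matrix.det_transpose, Matrix.det_apply']
      rfl
    rw [this]
    refine HasFDerivAt.fun_sum fun σ _ => ?_
    refine HasFDerivAt.const_mul ?_ _
    exact HasFDerivAt.finsetProd fun l _ => (hM l (σ l)).hasFDerivAt
  simp only [hdet]
  rw [Finset.sum_comm]
  simp only [Dop, hd.fderiv]
  simp only [sum_apply, smul_apply, smul_eq_mul,
    Finset.mul_sum, ← Finset.sum_add_distrib]
  refine Finset.sum_congr rfl fun σ _ => Finset.sum_congr rfl fun l _ => ?_
  ring

lemma swap_det (A : Matrix (Fin n) (Fin n) ℂ) (e r : Fin n → ℂ) {a b : Fin n} (hab : a ≠ b) :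
    ((A.updateRow a e).updateRow b r).det = - ((A.updateRow b e).updateRow a r).det := by
  have h : (A.updateRow a e).updateRow b r
      = ((A.updateRow b e).updateRow a r).submatrix (Equiv.swap a b) id := by
    ext x y
    simp only [Matrix.submatrix_apply, id]
    by_cases hx : x = a
    · subst hx
      rw [Equiv.swap_apply_left, Matrix.updateRow_ne hab, Matrix.updateRow_self,
        Matrix.updateRow_ne hab.symm, Matrix.updateRow_self]
    · by_cases hx' : x = b
      · subst hx'
        rw [Equiv.swap_apply_right, Matrix.updateRow_self, Matrix.updateRow_self]
      · rw [Equiv.swap_apply_of_ne_of_ne hx hx', Matrix.updateRow_ne hx',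
          Matrix.updateRow_ne hx, Matrix.updateRow_ne hx, Matrix.updateRow_ne hx']
  rw [h, Matrix.det_permute, Equiv.Perm.sign_swap hab]
  simp

/-- Piola identity. -/
lemma piola {H : EuclideanSpace ℂ (Fin n) → Matrix (Fin n) (Fin n) ℂ}
    (hH : ∀ a b, DifferentiableAt ℝ (fun w => H w a b) z)
    (hs : ∀ a b l, Dop c a (fun w => H w b l) z = Dop c b (fun w => H w a l) z) (k : Fin n) :
    ∑ j, Dop c j (fun w => (H w).adjugate k j) z = 0 := by
  have h1 : ∀ j, Dop c j (fun w => (H w).adjugate k j) z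
      = ∑ l, if l = j then 0 else (((H z).updateRow j (Pi.single k 1)).updateRow l
          (fun b => Dop c j (fun w => H w l b) z)).det := by
    intro j
    simp only [Matrix.adjugate_apply]
    rw [Dop_det]
    · refine Finset.sum_congr rfl fun l _ => ?_
      split_ifs with h
      · subst h
        refine Matrix.det_eq_zero_of_row_eq_zero l fun b => ?_
        simp [Dop]
      · simp only [Matrix.updateRow_ne h]
    · intro a b
      by_cases h : a = j
      · subst h; simp
      · simp only [Matrix.updateRow_ne h]; exact hH a b
  simp only [h1]
  have h2 : ∀ S : ℂ, S = -S → S = 0 := by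
    intro S h
    linear_combination (1/2) * h
  apply h2
  conv_rhs => rw [Finset.sum_comm]
  rw [← Finset.sum_neg_distrib]
  refine Finset.sum_congr rfl fun a _ => ?_
  rw [← Finset.sum_neg_distrib]
  refine Finset.sum_congr rfl fun b _ => ?_
  by_cases h : b = a
  · simp [h]
  · rw [if_neg h, if_neg (Ne.symm h), swap_det _ _ _ (Ne.symm h)]
    simp only [hs a b]

end DopLemmas
lemma wedge_formula {n : ℕ} (hn : 1 ≤ n) (A H : Matrix (Fin n) (Fin n) ℂ) :
    wedgeDensity n (fun j => if (j : ℕ) = 0 then A else H)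
      = ((n - 1).factorial : ℂ) * ∑ k, ∑ j, H.adjugate k j * A j k := by
  obtain ⟨m, rfl⟩ : ∃ m, n = m + 1 := ⟨n - 1, by omega⟩
  have h1 : ∀ π : Equiv.Perm (Fin (m + 1)),
      ∑ σ : Equiv.Perm (Fin (m + 1)), ((Equiv.Perm.sign σ : ℤ) : ℂ) *
        ∏ i, (if ((π i : Fin (m + 1)) : ℕ) = 0 then A else H) (σ i) i
      = ∑ j, H.adjugate (π⁻¹ 0) j * A j (π⁻¹ 0) := by
    intro π
    have h2 : ∑ j, H.adjugate (π⁻¹ 0) j * A j (π⁻¹ 0)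
        = (H.updateCol (π⁻¹ 0) (fun j => A j (π⁻¹ 0))).det := by
      rw [← Matrix.cramer_apply, Matrix.cramer_eq_adjugate_mulVec]
      rfl
    rw [h2, Matrix.det_apply']
    refine Finset.sum_congr rfl fun σ _ => ?_
    congr 1
    refine Finset.prod_congr rfl fun i _ => ?_
    by_cases h : π i = 0
    · have h' : i = π⁻¹ 0 := by rw [← h]; simp
      have e : π (π⁻¹ 0) = 0 := by simp
      rw [h', e, Matrix.updateCol_self]
      rfl
    · have h' : i ≠ π⁻¹ 0 := by
        rintro rfl
        simp at h
      rw [Matrix.updateCol_ne h', if_neg]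
      exact fun h0 => h (Fin.ext h0)
  unfold wedgeDensity
  rw [Finset.sum_comm]
  simp only [h1]
  rw [← Equiv.sum_comp (Equiv.inv (Equiv.Perm (Fin (m + 1))))
    (fun π => ∑ j, H.adjugate (π⁻¹ 0) j * A j (π⁻¹ 0))]
  simp only [Equiv.inv_apply, inv_inv]
  rw [← Equiv.sum_comp (Equiv.Perm.decomposeFin (n := m)).symm
    (fun π => ∑ j, H.adjugate (π 0) j * A j (π 0))]
  rw [Fintype.sum_prod_type]
  simp only [Equiv.Perm.decomposeFin_symm_apply_zero, Finset.sum_const, Finset.card_univ,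
    Fintype.card_perm, Fintype.card_fin, nsmul_eq_mul, ← Finset.mul_sum]
  simp

section IntLemmas

variable {n : ℕ} {Ω K : Set (EuclideanSpace ℂ (Fin n))} {F : EuclideanSpace ℂ (Fin n) → ℂ}

lemma integral_Dop_zero (hΩ : IsOpen Ω) (hK : IsCompact K) (hKΩ : K ⊆ Ω)
    (hF : ContDiffOn ℝ (⊤ : ℕ∞) F Ω) (hF0 : ∀ z ∈ Ω, z ∉ K → F z = 0) (c : ℂ) (j : Fin n) :
    IntegrableOn (Dop c j F) Ω ∧ ∫ z in Ω, Dop c j F z = 0 := by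
  have : (volume : Measure (EuclideanSpace ℂ (Fin n))).IsAddHaarMeasure :=
    inferInstanceAs (Measure.addHaar : Measure (EuclideanSpace ℂ (Fin n))).IsAddHaarMeasure
  set G : EuclideanSpace ℂ (Fin n) → ℂ := Ω.indicator F with hG
  have hGK : ∀ z, z ∉ K → G z = 0 := by
    intro z hz
    by_cases h : z ∈ Ω
    · rw [hG, Set.indicator_of_mem h, hF0 z h hz]
    · rw [hG, Set.indicator_of_notMem h]
  have hGF : ∀ z ∈ Ω, G =ᶠ[nhds z] F := by
    intro z hz
    filter_upwards [hΩ.mem_nhds hz] with w hw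
    rw [hG, Set.indicator_of_mem hw]
  have hG0 : ∀ z, z ∉ K → G =ᶠ[nhds z] fun _ => 0 := by
    intro z hz
    filter_upwards [hK.isClosed.isOpen_compl.mem_nhds hz] with w hw
    exact hGK w hw
  have hGs : ContDiff ℝ (⊤ : ℕ∞) G := by
    rw [contDiff_iff_contDiffAt]
    intro z
    by_cases h : z ∈ K
    · exact (hF.contDiffAt (hΩ.mem_nhds (hKΩ h))).congr_of_eventuallyEq (hGF z (hKΩ h))
    · exact contDiffAt_const.congr_of_eventuallyEq (hG0 z h)
  have hGc : HasCompactSupport G := HasCompactSupport.intro hK hGK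
  have hcont : ∀ u, Continuous (fun z => fderiv ℝ G z u) := fun u =>
    (hGs.continuous_fderiv (by simp)).clm_apply continuous_const
  have hint : ∀ u, Integrable (fun z => fderiv ℝ G z u) :=
    fun u => (hcont u).integrable_of_hasCompactSupport (hGc.fderiv_apply ℝ u)
  have hzero : ∀ u, ∫ z, fderiv ℝ G z u = 0 := by
    intro u
    have := integral_mul_fderiv_eq_neg_fderiv_mul_of_integrable
      (μ := (volume : Measure (EuclideanSpace ℂ (Fin n))))
      (f := fun _ : EuclideanSpace ℂ (Fin n) => (1 : ℂ)) (g := G) (v := u)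
      (by simp) (by simpa using hint u)
      (by simpa using hGs.continuous.integrable_of_hasCompactSupport hGc)
      (fun x _ => differentiableAt_const _)
      (fun x _ => (hGs.differentiable (by simp)) x)
    simpa using this
  have hDint : Integrable (Dop c j G) := by
    unfold Dop
    exact ((hint _).add ((hint _).const_mul c)).const_mul _
  have hDzero : ∫ z, Dop c j G z = 0 := by
    unfold Dop
    rw [integral_const_mul, integral_add (hint _) ((hint _).const_mul c), integral_const_mul,
      hzero, hzero]
    simp
  have hD : ∀ z ∈ Ω, Dop c j G z = Dop c j F z := fun z hz => Dop_congr (hGF z hz)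
  have hD0 : ∀ z, z ∉ Ω → Dop c j G z = 0 := by
    intro z hz
    rw [Dop_congr (hG0 z fun h => hz (hKΩ h))]
    simp [Dop]
  constructor
  · exact (hDint.integrableOn (s := Ω)).congr_fun hD hΩ.measurableSet
  · rw [← setIntegral_congr_fun hΩ.measurableSet hD, setIntegral_eq_integral_of_forall_compl_eq_zero
      hD0, hDzero]

lemma contDiffOn_det {M : EuclideanSpace ℂ (Fin n) → Matrix (Fin n) (Fin n) ℂ}
    (hM : ∀ a b, ContDiffOn ℝ (⊤ : ℕ∞) (fun w => M w a b) Ω) :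
    ContDiffOn ℝ (⊤ : ℕ∞) (fun w => (M w).det) Ω := by
  simp only [Matrix.det_apply']
  refine ContDiffOn.sum fun σ _ => contDiffOn_const.mul ?_
  exact contDiffOn_prod fun i _ => hM _ _

lemma contDiffOn_adj {M : EuclideanSpace ℂ (Fin n) → Matrix (Fin n) (Fin n) ℂ}
    (hM : ∀ a b, ContDiffOn ℝ (⊤ : ℕ∞) (fun w => M w a b) Ω) (k j : Fin n) :
    ContDiffOn ℝ (⊤ : ℕ∞) (fun w => (M w).adjugate k j) Ω := by
  simp only [Matrix.adjugate_apply]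
  refine contDiffOn_det fun a b => ?_
  by_cases h : a = j
  · subst h; simp only [Matrix.updateRow_self]; exact contDiffOn_const
  · simp only [Matrix.updateRow_ne h]; exact hM a b

/-- The integrated identity: two integrations by parts. -/
lemma main_identity (hΩ : IsOpen Ω) (hK : IsCompact K) (hKΩ : K ⊆ Ω)
    {φ v : EuclideanSpace ℂ (Fin n) → ℝ}
    (hφ : ContDiffOn ℝ (⊤ : ℕ∞) φ Ω) (hv : ContDiffOn ℝ (⊤ : ℕ∞) v Ω)
    {h : ℝ → ℝ} (hh : ContDiff ℝ (⊤ : ℕ∞) h) (h0 : ∀ z ∈ Ω, z ∉ K → h (φ z) = 0) :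
    ∫ z in Ω, (((h (φ z) : ℝ) : ℂ) * ∑ k, ∑ j, (cHess n φ z).adjugate k j * cHess n v z j k
      - ((v z : ℝ) : ℂ) * (((deriv (deriv h) (φ z) : ℝ) : ℂ) *
          ∑ k, ∑ j, (cHess n φ z).adjugate k j * gradForm n φ z j k
        + ((deriv h (φ z) : ℝ) : ℂ) *
          ∑ k, ∑ j, (cHess n φ z).adjugate k j * cHess n φ z j k)) = 0 := by
  have ofR : ∀ {f : EuclideanSpace ℂ (Fin n) → ℝ}, ContDiffOn ℝ (⊤ : ℕ∞) f Ω →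
      ContDiffOn ℝ (⊤ : ℕ∞) (fun w => ((f w : ℝ) : ℂ)) Ω := fun hf =>
    Complex.ofRealCLM.contDiff.comp_contDiffOn hf
  set Φ : EuclideanSpace ℂ (Fin n) → ℂ := fun w => ((φ w : ℝ) : ℂ) with hΦdef
  set V : EuclideanSpace ℂ (Fin n) → ℂ := fun w => ((v w : ℝ) : ℂ) with hVdef
  set P : EuclideanSpace ℂ (Fin n) → ℂ := fun w => ((h (φ w) : ℝ) : ℂ) with hPdef
  have hΦ : ContDiffOn ℝ (⊤ : ℕ∞) Φ Ω := ofR hφ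
  have hV : ContDiffOn ℝ (⊤ : ℕ∞) V Ω := ofR hv
  have hP : ContDiffOn ℝ (⊤ : ℕ∞) P Ω := ofR (hh.comp_contDiffOn hφ)
  set H : EuclideanSpace ℂ (Fin n) → Matrix (Fin n) (Fin n) ℂ := fun w =>
    Matrix.of fun a b => Dop (-Complex.I) a (Dop Complex.I b Φ) w with hHdef
  have hHs : ∀ a b, ContDiffOn ℝ (⊤ : ℕ∞) (fun w => H w a b) Ω := fun a b =>
    Dop_contDiffOn hΩ (Dop_contDiffOn hΩ hΦ)
  have hC := contDiffOn_adj hHs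
  have dAt : ∀ {F : EuclideanSpace ℂ (Fin n) → ℂ}, ContDiffOn ℝ (⊤ : ℕ∞) F Ω → ∀ z ∈ Ω,
      DifferentiableAt ℝ F z := fun hF z hz =>
    (hF.contDiffAt (hΩ.mem_nhds hz)).differentiableAt (by simp)
  have cAt : ∀ {F : EuclideanSpace ℂ (Fin n) → ℂ}, ContDiffOn ℝ (⊤ : ℕ∞) F Ω → ∀ z ∈ Ω,
      ContDiffAt ℝ (⊤ : ℕ∞) F z := fun hF z hz => hF.contDiffAt (hΩ.mem_nhds hz)
  -- vanishing of the divergence of the cofactors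
  have piola1 : ∀ z ∈ Ω, ∀ k, ∑ j, Dop (-Complex.I) j (fun w => (H w).adjugate k j) z = 0 := by
    intro z hz k
    refine piola (fun a b => dAt (hHs a b) z hz) (fun a b l => ?_) k
    exact Dop_comm (cAt (Dop_contDiffOn hΩ hΦ) z hz)
  have piola2 : ∀ z ∈ Ω, ∀ j, ∑ k, Dop Complex.I k (fun w => (H w).adjugate k j) z = 0 := by
    intro z hz j
    have := piola (c := Complex.I) (z := z) (H := fun w => (H w).transpose)
      (fun a b => dAt (hHs b a) z hz) (fun a b l => ?_) j
    · simpa only [← Matrix.adjugate_transpose, Matrix.transpose_apply] using this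
    · change Dop Complex.I a (Dop (-Complex.I) l (Dop Complex.I b Φ)) z
        = Dop Complex.I b (Dop (-Complex.I) l (Dop Complex.I a Φ)) z
      rw [Dop_comm (c := Complex.I) (j := a) (d := -Complex.I) (k := l)
          (cAt (Dop_contDiffOn hΩ hΦ) z hz),
        Dop_comm (c := Complex.I) (j := b) (d := -Complex.I) (k := l)
          (cAt (Dop_contDiffOn hΩ hΦ) z hz)]
      refine Dop_congr ?_
      filter_upwards [hΩ.mem_nhds hz] with w hw
      exact Dop_comm (cAt hΦ w hw)
  -- the two families of compactly supported fields
  have hP0 : ∀ z ∈ Ω, z ∉ K → P =ᶠ[nhds z] fun _ => 0 := by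
    intro z hz hzK
    filter_upwards [hK.isClosed.isOpen_compl.mem_nhds hzK, hΩ.mem_nhds hz] with w hw hw'
    simp [hPdef, h0 w hw' hw]
  have I1 : ∀ k j, _ := fun k j => integral_Dop_zero hΩ hK hKΩ
    (F := fun w => P w * ((H w).adjugate k j * Dop Complex.I k V w))
    (hP.mul ((hC k j).mul (Dop_contDiffOn hΩ hV)))
    (fun z hz hzK => by simp [(hP0 z hz hzK).self_of_nhds]) (-Complex.I) j
  have I2 : ∀ k j, _ := fun k j => integral_Dop_zero hΩ hK hKΩ
    (F := fun w => V w * ((H w).adjugate k j * Dop (-Complex.I) j P w))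
    (hV.mul ((hC k j).mul (Dop_contDiffOn hΩ hP)))
    (fun z hz hzK => by rw [Dop_congr (hP0 z hz hzK)]; simp [Dop]) Complex.I k
  have total : ∫ z in Ω, ∑ k, ∑ j,
      (Dop (-Complex.I) j (fun w => P w * ((H w).adjugate k j * Dop Complex.I k V w)) z
        - Dop Complex.I k (fun w => V w * ((H w).adjugate k j * Dop (-Complex.I) j P w)) z) = 0 := by
    have I3 : ∀ k j, IntegrableOn (fun z =>
        (Dop (-Complex.I) j (fun w => P w * ((H w).adjugate k j * Dop Complex.I k V w)) z
        - Dop Complex.I k (fun w => V w * ((H w).adjugate k j * Dop (-Complex.I) j P w)) z)) Ω :=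
      fun k j => (I1 k j).1.sub (I2 k j).1
    rw [integral_finsetSum _ fun k _ => integrable_finsetSum _ fun j _ => I3 k j]
    refine Finset.sum_eq_zero fun k _ => ?_
    rw [integral_finsetSum _ fun j _ => I3 k j]
    refine Finset.sum_eq_zero fun j _ => ?_
    rw [integral_sub (I1 k j).1 (I2 k j).1, (I1 k j).2, (I2 k j).2, sub_zero]
  rw [← total]
  refine setIntegral_congr_fun hΩ.measurableSet fun z hz => ?_
  have hHz : cHess n φ z = H z := by
    ext a b
    exact cHess_eq_Dop hΩ hφ hz
  have hVz : ∀ a b, cHess n v z a b = Dop (-Complex.I) a (Dop Complex.I b V) z := fun a b =>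
    cHess_eq_Dop hΩ hv hz
  have dφ : ∀ w ∈ Ω, DifferentiableAt ℝ φ w := fun w hw =>
    (hφ.contDiffAt (hΩ.mem_nhds hw)).differentiableAt (by simp)
  have hgz : ∀ a b, gradForm n φ z a b = Dop (-Complex.I) a Φ z * Dop Complex.I b Φ z := by
    intro a b
    simp only [gradForm, Matrix.of_apply]
    rw [conj_wderiv, wderiv_eq_Dop (dφ z hz), wbar_eq_Dop (dφ z hz)]
  have hh1 : ContDiff ℝ (⊤ : ℕ∞) (deriv h) := by
    apply ContDiff.iterate_deriv 1 hh
  set Q : EuclideanSpace ℂ (Fin n) → ℂ := fun w => ((deriv h (φ w) : ℝ) : ℂ) with hQdef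
  have hQ : ContDiffOn ℝ (⊤ : ℕ∞) Q Ω := ofR (hh1.comp_contDiffOn hφ)
  have hDP : ∀ w ∈ Ω, ∀ a c, Dop c a P w = Q w * Dop c a Φ w := fun w hw a c =>
    Dop_real_comp (hh.differentiable (by simp) _) (dφ w hw)
  have hDDP : ∀ a b, Dop Complex.I b (Dop (-Complex.I) a P) z
      = ((deriv (deriv h) (φ z) : ℝ) : ℂ) * (Dop (-Complex.I) a Φ z * Dop Complex.I b Φ z)
        + Q z * H z a b := by
    intro a b
    have e : Dop (-Complex.I) a P =ᶠ[nhds z] fun w => Q w * Dop (-Complex.I) a Φ w := by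
      filter_upwards [hΩ.mem_nhds hz] with w hw
      exact hDP w hw a _
    rw [Dop_congr e, Dop_mul (dAt hQ z hz) (dAt (Dop_contDiffOn hΩ hΦ) z hz),
      Dop_comm (cAt hΦ z hz)]
    have : Dop Complex.I b Q z = ((deriv (deriv h) (φ z) : ℝ) : ℂ) * Dop Complex.I b Φ z :=
      Dop_real_comp (hh1.differentiable (by simp) _) (dφ z hz)
    rw [this]
    simp only [hHdef, Matrix.of_apply]
    ring
  have T1 : ∀ k j, Dop (-Complex.I) j (fun w => P w * ((H w).adjugate k j * Dop Complex.I k V w)) z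
      = Dop (-Complex.I) j P z * ((H z).adjugate k j * Dop Complex.I k V z)
        + P z * (Dop (-Complex.I) j (fun w => (H w).adjugate k j) z * Dop Complex.I k V z
        + (H z).adjugate k j * cHess n v z j k) := by
    intro k j
    rw [Dop_mul (dAt hP z hz) (dAt ((hC k j).mul (Dop_contDiffOn hΩ hV)) z hz),
      Dop_mul (dAt (hC k j) z hz) (dAt (Dop_contDiffOn hΩ hV) z hz), hVz]
  have T2 : ∀ k j, Dop Complex.I k (fun w => V w * ((H w).adjugate k j * Dop (-Complex.I) j P w)) z
      = Dop Complex.I k V z * ((H z).adjugate k j * Dop (-Complex.I) j P z)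
        + V z * (Dop Complex.I k (fun w => (H w).adjugate k j) z * Dop (-Complex.I) j P z
        + (H z).adjugate k j * (((deriv (deriv h) (φ z) : ℝ) : ℂ) * gradForm n φ z j k
          + Q z * H z j k)) := by
    intro k j
    rw [Dop_mul (dAt hV z hz) (dAt ((hC k j).mul (Dop_contDiffOn hΩ hP)) z hz),
      Dop_mul (dAt (hC k j) z hz) (dAt (Dop_contDiffOn hΩ hP) z hz), hDDP, hgz]
  have S1 : ∑ k, ∑ j, P z * (Dop (-Complex.I) j (fun w => (H w).adjugate k j) z
      * Dop Complex.I k V z) = 0 := by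
    refine Finset.sum_eq_zero fun k _ => ?_
    rw [← Finset.mul_sum, ← Finset.sum_mul, piola1 z hz k]
    simp
  have S2 : ∑ k, ∑ j, V z * (Dop Complex.I k (fun w => (H w).adjugate k j) z
      * Dop (-Complex.I) j P z) = 0 := by
    rw [Finset.sum_comm]
    refine Finset.sum_eq_zero fun j _ => ?_
    rw [← Finset.mul_sum, ← Finset.sum_mul, piola2 z hz j]
    simp
  have expand : ∑ k, ∑ j,
      (Dop (-Complex.I) j (fun w => P w * ((H w).adjugate k j * Dop Complex.I k V w)) z
        - Dop Complex.I k (fun w => V w * ((H w).adjugate k j * Dop (-Complex.I) j P w)) z)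
      = ∑ k, ∑ j, P z * (Dop (-Complex.I) j (fun w => (H w).adjugate k j) z
          * Dop Complex.I k V z)
        - ∑ k, ∑ j, V z * (Dop Complex.I k (fun w => (H w).adjugate k j) z
          * Dop (-Complex.I) j P z)
        + (P z * ∑ k, ∑ j, (H z).adjugate k j * cHess n v z j k
          - V z * (((deriv (deriv h) (φ z) : ℝ) : ℂ) *
            ∑ k, ∑ j, (H z).adjugate k j * gradForm n φ z j k
            + Q z * ∑ k, ∑ j, (H z).adjugate k j * H z j k)) := by
    simp only [T1, T2, Finset.mul_sum, mul_add, ← Finset.sum_add_distrib,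
      ← Finset.sum_sub_distrib]
    refine Finset.sum_congr rfl fun k _ => Finset.sum_congr rfl fun j _ => ?_
    ring
  simp only [expand, S1, S2, hHz]
  ring

end IntLemmas
/-- A smooth regularisation of `s ↦ s²` on the negative half-line. -/
noncomputable def psiReg (s : ℝ) : ℝ := s ^ 2 * Real.smoothTransition (-s - 1)

lemma psiReg_contDiff : ContDiff ℝ (⊤ : ℕ∞) psiReg := by
  unfold psiReg
  exact (contDiff_id.pow 2).mul
    (Real.smoothTransition.contDiff.comp (contDiff_id.neg.sub contDiff_const))

lemma psiReg_zero {s : ℝ} (hs : -1 ≤ s) : psiReg s = 0 := by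
  rw [psiReg, Real.smoothTransition.zero_of_nonpos (by linarith), mul_zero]

lemma psiReg_sq {s : ℝ} (hs : s ≤ -2) : psiReg s = s ^ 2 := by
  rw [psiReg, Real.smoothTransition.one_of_one_le (by linarith), mul_one]

lemma psiReg_nonneg (s : ℝ) : 0 ≤ psiReg s :=
  mul_nonneg (sq_nonneg s) (Real.smoothTransition.nonneg _)

lemma psiReg_le (s : ℝ) : psiReg s ≤ s ^ 2 :=
  mul_le_of_le_one_right (sq_nonneg s) (Real.smoothTransition.le_one _)

lemma psiReg_antitone : Antitone psiReg := by
  intro s t hst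
  by_cases ht : -1 ≤ t
  · rw [psiReg_zero ht]; exact psiReg_nonneg s
  · push Not at ht
    refine mul_le_mul (by nlinarith) (Real.smoothTransition.monotone (by linarith))
      (Real.smoothTransition.nonneg _) (sq_nonneg s)

lemma psiReg_deriv_nonpos (s : ℝ) : deriv psiReg s ≤ 0 := psiReg_antitone.deriv_nonpos

lemma psiReg_deriv2_left {s : ℝ} (hs : s < -2) : deriv (deriv psiReg) s = 2 := by
  have h : psiReg =ᶠ[nhds s] fun x => x ^ 2 := by
    filter_upwards [Iio_mem_nhds hs] with x hx
    exact psiReg_sq (le_of_lt hx)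
  rw [h.deriv.deriv_eq]
  have : deriv (fun x : ℝ => x ^ 2) = fun x => 2 * x := by
    funext x; simp
  rw [this]
  simp

lemma psiReg_deriv2_right {s : ℝ} (hs : -1 < s) : deriv (deriv psiReg) s = 0 := by
  have h : psiReg =ᶠ[nhds s] fun _ => 0 := by
    filter_upwards [Ioi_mem_nhds hs] with x hx
    exact psiReg_zero (le_of_lt hx)
  rw [h.deriv.deriv_eq]
  simp

lemma psiReg_deriv2_contDiff : ContDiff ℝ (⊤ : ℕ∞) (deriv (deriv psiReg)) :=
  ContDiff.iterate_deriv 2 psiReg_contDiff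

lemma psiReg_deriv2_bound : ∃ B : ℝ, ∀ s, |deriv (deriv psiReg) s| ≤ B := by
  obtain ⟨B, hB⟩ := (isCompact_Icc (a := (-2 : ℝ)) (b := -1)).exists_bound_of_continuousOn
    psiReg_deriv2_contDiff.continuous.continuousOn
  refine ⟨max B 2, fun s => ?_⟩
  by_cases h1 : s < -2
  · rw [psiReg_deriv2_left h1]; simp
  · by_cases h2 : -1 < s
    · rw [psiReg_deriv2_right h2]; simp
    · exact (hB s ⟨by linarith, by linarith⟩).trans (le_max_left _ _)

/-- The rescaled regularisation. -/
noncomputable def hReg (m : ℝ) (t : ℝ) : ℝ := (m ^ 2)⁻¹ * psiReg (m * t)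

lemma hReg_contDiff (m : ℝ) : ContDiff ℝ (⊤ : ℕ∞) (hReg m) := by
  unfold hReg
  exact contDiff_const.mul (psiReg_contDiff.comp (contDiff_const.mul contDiff_id))

lemma hReg_deriv {m : ℝ} (hm : 0 < m) : deriv (hReg m) = fun t => m⁻¹ * deriv psiReg (m * t) := by
  funext t
  have hd : DifferentiableAt ℝ (fun t => psiReg (m * t)) t :=
    ((psiReg_contDiff.comp (contDiff_const.mul contDiff_id)).differentiable (by simp)) t
  unfold hReg
  rw [deriv_const_mul _ hd, deriv_comp_mul_left, smul_eq_mul]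
  field_simp

lemma hReg_deriv2 {m : ℝ} (hm : 0 < m) :
    deriv (deriv (hReg m)) = fun t => deriv (deriv psiReg) (m * t) := by
  rw [hReg_deriv hm]
  funext t
  have h1 : ContDiff ℝ (⊤ : ℕ∞) (deriv psiReg) := ContDiff.iterate_deriv 1 psiReg_contDiff
  have hd : DifferentiableAt ℝ (fun t => deriv psiReg (m * t)) t :=
    ((h1.comp (contDiff_const.mul contDiff_id)).differentiable (by simp)) t
  rw [deriv_const_mul _ hd, deriv_comp_mul_left, smul_eq_mul]
  field_simp

lemma cHess_contDiffOn {n : ℕ} {W : Set (EuclideanSpace ℂ (Fin n))} (hW : IsOpen W)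
    {f : EuclideanSpace ℂ (Fin n) → ℝ} (hf : ContDiffOn ℝ (⊤ : ℕ∞) f W) (a b : Fin n) :
    ContDiffOn ℝ (⊤ : ℕ∞) (fun z => cHess n f z a b) W := by
  have h : ContDiffOn ℝ (⊤ : ℕ∞)
      (Dop (-Complex.I) a (Dop Complex.I b (fun w => ((f w : ℝ) : ℂ)))) W :=
    Dop_contDiffOn hW (Dop_contDiffOn hW (Complex.ofRealCLM.contDiff.comp_contDiffOn hf))
  exact h.congr fun z hz => cHess_eq_Dop hW hf hz

lemma gradForm_contDiffOn {n : ℕ} {W : Set (EuclideanSpace ℂ (Fin n))} (hW : IsOpen W)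
    {f : EuclideanSpace ℂ (Fin n) → ℝ} (hf : ContDiffOn ℝ (⊤ : ℕ∞) f W) (a b : Fin n) :
    ContDiffOn ℝ (⊤ : ℕ∞) (fun z => gradForm n f z a b) W := by
  have h : ∀ c (a : Fin n), ContDiffOn ℝ (⊤ : ℕ∞) (Dop c a (fun w => ((f w : ℝ) : ℂ))) W :=
    fun c a => Dop_contDiffOn hW (Complex.ofRealCLM.contDiff.comp_contDiffOn hf)
  refine ((h (-Complex.I) a).mul (h Complex.I b)).congr fun z hz => ?_
  have hd : DifferentiableAt ℝ f z :=
    (hf.contDiffAt (hW.mem_nhds hz)).differentiableAt (by simp)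
  simp only [gradForm, Matrix.of_apply]
  rw [conj_wderiv, wderiv_eq_Dop hd, wbar_eq_Dop hd]

/-- The pairing of the adjugate of `H` with `A`. -/
noncomputable def adjPair {n : ℕ} (H A : Matrix (Fin n) (Fin n) ℂ) : ℂ :=
  ∑ k, ∑ j, H.adjugate k j * A j k

lemma adjPair_contDiffOn {n : ℕ} {W : Set (EuclideanSpace ℂ (Fin n))}
    {H A : EuclideanSpace ℂ (Fin n) → Matrix (Fin n) (Fin n) ℂ}
    (hH : ∀ a b, ContDiffOn ℝ (⊤ : ℕ∞) (fun w => H w a b) W)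
    (hA : ∀ a b, ContDiffOn ℝ (⊤ : ℕ∞) (fun w => A w a b) W) :
    ContDiffOn ℝ (⊤ : ℕ∞) (fun w => adjPair (H w) (A w)) W := by
  unfold adjPair
  exact ContDiffOn.sum fun k _ => ContDiffOn.sum fun j _ => (contDiffOn_adj hH k j).mul (hA j k)

lemma adjPair_self_re {n : ℕ} {H : Matrix (Fin n) (Fin n) ℂ} (hH : H.PosSemidef) :
    0 ≤ (adjPair H H).re := by
  have h1 : adjPair H H = (n : ℂ) * H.det := by
    have : adjPair H H = (H.adjugate * H).trace := rfl
    rw [this, Matrix.adjugate_mul]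
    simp [Matrix.trace_smul, mul_comm]
  have h2 : 0 ≤ H.det.re := (Complex.le_def.1 hH.det_nonneg).1
  rw [h1]
  simp only [Complex.mul_re, Complex.natCast_re, Complex.natCast_im, zero_mul, sub_zero]
  positivity

/-- Inequality (3): `∫_Ω φ² i∂∂̄v ∧ (i∂∂̄φ)^{n-1} ≤ 2 ∫_Ω v i∂φ ∧ ∂̄φ ∧ (i∂∂̄φ)^{n-1}`
for `φ` smooth psh on `Ω̄`, negative in `Ω`, vanishing on `∂Ω`, and `v ≥ 0` smooth psh. -/
theorem stmt6 (n : ℕ) (hn : 1 ≤ n) (Ω : Set (EuclideanSpace ℂ (Fin n)))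
    (hΩo : IsOpen Ω) (hb : Bornology.IsBounded Ω)
    (W : Set (EuclideanSpace ℂ (Fin n))) (hWo : IsOpen W) (hWΩ : closure Ω ⊆ W)
    (φ v : EuclideanSpace ℂ (Fin n) → ℝ)
    (hφ : ContDiffOn ℝ (⊤ : ℕ∞) φ W) (hv : ContDiffOn ℝ (⊤ : ℕ∞) v W)
    (hφpsh : ∀ z ∈ Ω, (cHess n φ z).PosSemidef)
    (hvpsh : ∀ z ∈ Ω, (cHess n v z).PosSemidef)
    (hφneg : ∀ z ∈ Ω, φ z < 0)
    (hφ0 : ∀ z ∈ frontier Ω, φ z = 0)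
    (hvpos : ∀ z ∈ Ω, 0 ≤ v z) :
    ∫ z in Ω, (φ z) ^ 2 *
        (wedgeDensity n (fun j => if (j : ℕ) = 0 then cHess n v z else cHess n φ z)).re
      ≤ 2 * ∫ z in Ω, v z *
        (wedgeDensity n (fun j => if (j : ℕ) = 0 then gradForm n φ z else cHess n φ z)).re := by
  have hΩW : Ω ⊆ W := subset_closure.trans hWΩ
  have hcpt : IsCompact (closure Ω) := hb.isCompact_closure
  have : (volume : Measure (EuclideanSpace ℂ (Fin n))).IsAddHaarMeasure :=
    inferInstanceAs (Measure.addHaar : Measure (EuclideanSpace ℂ (Fin n))).IsAddHaarMeasure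
  set a : EuclideanSpace ℂ (Fin n) → ℂ := fun z => adjPair (cHess n φ z) (cHess n v z) with ha
  set b : EuclideanSpace ℂ (Fin n) → ℂ := fun z => adjPair (cHess n φ z) (gradForm n φ z) with hb'
  set d : EuclideanSpace ℂ (Fin n) → ℂ := fun z => adjPair (cHess n φ z) (cHess n φ z) with hd
  have ca : ContinuousOn a (closure Ω) := (adjPair_contDiffOn (cHess_contDiffOn hWo hφ)
    (cHess_contDiffOn hWo hv)).continuousOn.mono hWΩ
  have cb : ContinuousOn b (closure Ω) := (adjPair_contDiffOn (cHess_contDiffOn hWo hφ)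
    (gradForm_contDiffOn hWo hφ)).continuousOn.mono hWΩ
  have cd : ContinuousOn d (closure Ω) := (adjPair_contDiffOn (cHess_contDiffOn hWo hφ)
    (cHess_contDiffOn hWo hφ)).continuousOn.mono hWΩ
  have cφ : ContinuousOn φ (closure Ω) := hφ.continuousOn.mono hWΩ
  have cv : ContinuousOn v (closure Ω) := hv.continuousOn.mono hWΩ
  have re_cont : ∀ {f : EuclideanSpace ℂ (Fin n) → ℂ}, ContinuousOn f (closure Ω) →
      ContinuousOn (fun z => (f z).re) (closure Ω) := fun hf =>
    Complex.continuous_re.comp_continuousOn hf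
  have intR : ∀ {f : EuclideanSpace ℂ (Fin n) → ℝ}, ContinuousOn f (closure Ω) →
      IntegrableOn f Ω := fun hf => (hf.integrableOn_compact hcpt).mono_set subset_closure
  have intC : ∀ {f : EuclideanSpace ℂ (Fin n) → ℂ}, ContinuousOn f (closure Ω) →
      IntegrableOn f Ω := fun hf => (hf.integrableOn_compact hcpt).mono_set subset_closure
  have hsm : ∀ m : ℝ, 0 < m → Continuous (deriv (hReg m)) ∧ Continuous (deriv (deriv (hReg m))) :=
    fun m hm => ⟨(ContDiff.iterate_deriv 1 (hReg_contDiff m)).continuous,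
      (ContDiff.iterate_deriv 2 (hReg_contDiff m)).continuous⟩
  -- the regularised inequality
  have reg : ∀ m : ℝ, 0 < m → ∫ z in Ω, hReg m (φ z) * (a z).re
      ≤ ∫ z in Ω, v z * (deriv (deriv (hReg m)) (φ z) * (b z).re) := by
    intro m hm
    set K : Set (EuclideanSpace ℂ (Fin n)) := closure Ω ∩ φ ⁻¹' Set.Iic (-m⁻¹) with hKdef
    have hK : IsCompact K := hcpt.of_isClosed_subset
      (cφ.preimage_isClosed_of_isClosed isClosed_closure isClosed_Iic) Set.inter_subset_left
    have hKΩ : K ⊆ Ω := by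
      rintro z ⟨hz, hz'⟩
      by_contra hzΩ
      have : z ∈ frontier Ω := by rw [hΩo.frontier_eq]; exact ⟨hz, hzΩ⟩
      have h0 := hφ0 z this
      have h1 : φ z ≤ -m⁻¹ := hz'
      have : 0 < m⁻¹ := inv_pos.2 hm
      linarith
    have hvan : ∀ z ∈ Ω, z ∉ K → hReg m (φ z) = 0 := by
      intro z hz hzK
      have h1 : -m⁻¹ < φ z := by
        by_contra h
        exact hzK ⟨subset_closure hz, not_lt.1 h⟩
      have h2 : -1 ≤ m * φ z := by
        have := mul_lt_mul_of_pos_left h1 hm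
        rw [mul_neg, mul_inv_cancel₀ hm.ne'] at this
        exact this.le
      rw [hReg, psiReg_zero h2, mul_zero]
    have key := main_identity hΩo hK hKΩ (hφ.mono hΩW) (hv.mono hΩW) (hReg_contDiff m) hvan
    change ∫ z in Ω, (((hReg m (φ z) : ℝ) : ℂ) * a z - ((v z : ℝ) : ℂ) *
      (((deriv (deriv (hReg m)) (φ z) : ℝ) : ℂ) * b z
        + ((deriv (hReg m) (φ z) : ℝ) : ℂ) * d z)) = 0 at key
    have c0 : ContinuousOn (fun z => hReg m (φ z)) (closure Ω) :=
      (hReg_contDiff m).continuous.comp_continuousOn cφ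
    have c1 : ContinuousOn (fun z => deriv (hReg m) (φ z)) (closure Ω) :=
      (hsm m hm).1.comp_continuousOn cφ
    have c2 : ContinuousOn (fun z => deriv (deriv (hReg m)) (φ z)) (closure Ω) :=
      (hsm m hm).2.comp_continuousOn cφ
    have ofR : ∀ {f : EuclideanSpace ℂ (Fin n) → ℝ}, ContinuousOn f (closure Ω) →
      ContinuousOn (fun z => ((f z : ℝ) : ℂ)) (closure Ω) := fun hf =>
        Complex.continuous_ofReal.comp_continuousOn hf
    have hX : IntegrableOn (fun z => (((hReg m (φ z) : ℝ) : ℂ) * a z - ((v z : ℝ) : ℂ) *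
      (((deriv (deriv (hReg m)) (φ z) : ℝ) : ℂ) * b z
        + ((deriv (hReg m) (φ z) : ℝ) : ℂ) * d z))) Ω := intC (((ofR c0).mul ca).sub ((ofR cv).mul (((ofR c2).mul cb).add
      ((ofR c1).mul cd))))
    have key3 : ∫ z in Ω, (hReg m (φ z) * (a z).re - v z *
      (deriv (deriv (hReg m)) (φ z) * (b z).re + deriv (hReg m) (φ z) * (d z).re)) = 0 := by
      have e : (Complex.reCLM (∫ z in Ω, (((hReg m (φ z) : ℝ) : ℂ) * a z - ((v z : ℝ) : ℂ) *
        (((deriv (deriv (hReg m)) (φ z) : ℝ) : ℂ) * b z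
        + ((deriv (hReg m) (φ z) : ℝ) : ℂ) * d z)))) = 0 := by rw [key]; simp
      rw [← e, ← Complex.reCLM.integral_comp_comm hX]
      congr 1
      funext z
      simp
    have i1 : IntegrableOn (fun z => hReg m (φ z) * (a z).re) Ω := intR (c0.mul (re_cont ca))
    have i2 : IntegrableOn (fun z => v z * (deriv (deriv (hReg m)) (φ z) * (b z).re)) Ω := intR (cv.mul (c2.mul (re_cont cb)))
    have i3 : IntegrableOn (fun z => (hReg m (φ z) * (a z).re - v z *
      (deriv (deriv (hReg m)) (φ z) * (b z).re + deriv (hReg m) (φ z) * (d z).re))) Ω := intR ((c0.mul (re_cont ca)).sub (cv.mul ((c2.mul (re_cont cb)).add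
      (c1.mul (re_cont cd)))))
    have e4 : ∫ z in Ω, v z * (deriv (deriv (hReg m)) (φ z) * (b z).re)
        = ∫ z in Ω, (v z * (deriv (deriv (hReg m)) (φ z) * (b z).re)
          + (hReg m (φ z) * (a z).re - v z *
      (deriv (deriv (hReg m)) (φ z) * (b z).re + deriv (hReg m) (φ z) * (d z).re))) := by
      have := integral_add i2 i3
      rw [key3, add_zero] at this
      exact this.symm
    rw [e4]
    refine setIntegral_mono_on i1 (i2.add i3) hΩo.measurableSet fun z hz => ?_
    have hd0 : 0 ≤ (d z).re := adjPair_self_re (hφpsh z hz)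
    have hh1 : deriv (hReg m) (φ z) ≤ 0 := by
      rw [hReg_deriv hm]
      exact mul_nonpos_of_nonneg_of_nonpos (inv_pos.2 hm).le (psiReg_deriv_nonpos _)
    have : 0 ≤ v z * (-(deriv (hReg m) (φ z)) * (d z).re) :=
      mul_nonneg (hvpos z hz) (mul_nonneg (by linarith) hd0)
    nlinarith
  -- passage to the limit
  have ev : ∀ t : ℝ, t < 0 → ∀ᶠ m : ℕ in Filter.atTop, ((m : ℝ) + 1) * t < -2 := by
    intro t ht
    obtain ⟨N, hN⟩ := exists_nat_gt (2 / (-t))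
    filter_upwards [Filter.eventually_ge_atTop N] with m hm
    have h1 : 2 / (-t) < (m : ℝ) + 1 := by
      have : (N : ℝ) ≤ m := by exact_mod_cast hm
      linarith
    rw [div_lt_iff₀ (by linarith)] at h1
    linarith
  have mpos : ∀ m : ℕ, (0 : ℝ) < (m : ℝ) + 1 := fun m => by positivity
  obtain ⟨B, hB⟩ := psiReg_deriv2_bound
  have lim1 : Filter.Tendsto (fun m : ℕ => ∫ z in Ω, hReg ((m : ℝ) + 1) (φ z) * (a z).re)
      Filter.atTop (nhds (∫ z in Ω, (φ z) ^ 2 * (a z).re)) := by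
    refine tendsto_integral_of_dominated_convergence (fun z => ‖(φ z) ^ 2 * (a z).re‖) ?_ ?_ ?_ ?_
    · intro m
      exact (intR (((hReg_contDiff _).continuous.comp_continuousOn cφ).mul
        (re_cont ca))).aestronglyMeasurable
    · exact (intR ((cφ.pow 2).mul (re_cont ca))).norm
    · intro m
      refine Filter.Eventually.of_forall fun z => ?_
      rw [norm_mul, norm_mul]
      refine mul_le_mul_of_nonneg_right ?_ (norm_nonneg _)
      have h1 : 0 ≤ hReg ((m : ℝ) + 1) (φ z) :=
        mul_nonneg (by positivity) (psiReg_nonneg _)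
      rw [Real.norm_of_nonneg h1, Real.norm_of_nonneg (sq_nonneg _), hReg,
        inv_mul_le_iff₀ (pow_pos (mpos m) 2), ← mul_pow]
      exact psiReg_le _
    · refine (ae_restrict_iff' hΩo.measurableSet).2 (Filter.Eventually.of_forall fun z hz => ?_)
      refine tendsto_const_nhds.congr' ?_
      filter_upwards [ev (φ z) (hφneg z hz)] with m hm
      rw [hReg, psiReg_sq hm.le, mul_pow, inv_mul_cancel_left₀ (pow_pos (mpos m) 2).ne']
  have lim2 : Filter.Tendsto (fun m : ℕ => ∫ z in Ω,
      v z * (deriv (deriv (hReg ((m : ℝ) + 1))) (φ z) * (b z).re))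
      Filter.atTop (nhds (∫ z in Ω, v z * (2 * (b z).re))) := by
    refine tendsto_integral_of_dominated_convergence (fun z => B * ‖v z * (b z).re‖) ?_ ?_ ?_ ?_
    · intro m
      exact (intR (cv.mul (((hsm _ (mpos m)).2.comp_continuousOn cφ).mul
        (re_cont cb)))).aestronglyMeasurable
    · exact (intR (cv.mul (re_cont cb))).norm.const_mul B
    · intro m
      refine Filter.Eventually.of_forall fun z => ?_
      rw [mul_left_comm, norm_mul]
      refine mul_le_mul_of_nonneg_right ?_ (norm_nonneg _)
      rw [hReg_deriv2 (mpos m)]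
      exact hB _
    · refine (ae_restrict_iff' hΩo.measurableSet).2 (Filter.Eventually.of_forall fun z hz => ?_)
      refine tendsto_const_nhds.congr' ?_
      filter_upwards [ev (φ z) (hφneg z hz)] with m hm
      rw [hReg_deriv2 (mpos m)]
      simp only [psiReg_deriv2_left hm]
  have fin : ∫ z in Ω, (φ z) ^ 2 * (a z).re ≤ ∫ z in Ω, v z * (2 * (b z).re) :=
    le_of_tendsto_of_tendsto' lim1 lim2 fun m => reg _ (mpos m)
  have wa : ∀ (z : EuclideanSpace ℂ (Fin n)) (A : Matrix (Fin n) (Fin n) ℂ),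
      (wedgeDensity n (fun j => if (j : ℕ) = 0 then A else cHess n φ z)).re
        = ((n - 1).factorial : ℝ) * (adjPair (cHess n φ z) A).re := by
    intro z A
    rw [wedge_formula hn]
    change (((n - 1).factorial : ℂ) * adjPair (cHess n φ z) A).re = _
    simp [Complex.mul_re]
  simp only [wa]
  have e1 : ∀ z, φ z ^ 2 * (((n - 1).factorial : ℝ) * (adjPair (cHess n φ z) (cHess n v z)).re)
      = ((n - 1).factorial : ℝ) * (φ z ^ 2 * (a z).re) := fun z => by rw [ha]; ring
  have e2 : ∀ z, v z * (((n - 1).factorial : ℝ) * (adjPair (cHess n φ z) (gradForm n φ z)).re)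
      = (((n - 1).factorial : ℝ) / 2) * (v z * (2 * (b z).re)) := fun z => by rw [hb']; ring
  simp only [e1, e2, integral_const_mul]
  have : (0 : ℝ) ≤ ((n - 1).factorial : ℝ) := by positivity
  nlinarith [mul_le_mul_of_nonneg_left fin this]
end
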